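/- Key inequality L2 (adjacent-swap inequality) for positively correlated channels: assume p11 ≥ p01, 0 ≤ β ≤ 1, and β·ℛ̄ ≤ ℛ̲. Then for every t ∈ {1,…,T}, every j ∈ {1,…,N−1}, every belief vector ω ∈ [0,1]^N with p11 ≥ ω₁ ≥ ω₂ ≥ … ≥ ω_N ≥ p01, and every x, y ∈ [p01, p11] with x ≥ y, it holds that W_t(ω₁, …, ω_{j−1}, x, y, ω_{j+2}, …, ω_N) ≥ W_t(ω₁, …, ω_{j−1}, y, x, ω_{j+2}, …, ω_N). -/

import Mathlib

open Finset

noncomputable section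

/-- Belief update map `τ(ω) = ω·p11 + (1-ω)·p01`. -/
def tau (p01 p11 ω : ℝ) : ℝ := ω * p11 + (1 - ω) * p01

/-- Expected one-step reward `R_m(ω; S)` with access cap `m`:
the expectation of `min(#available, m)` when each channel `i ∈ S` is
independently available with probability `ω i`. -/
def expReward {ι : Type*} [DecidableEq ι] (m : ℕ) (S : Finset ι) (ω : ι → ℝ) : ℝ :=
  ∑ A ∈ S.powerset,
    (∏ i ∈ A, ω i) * (∏ i ∈ S \ A, (1 - ω i)) * ((min A.card m : ℕ) : ℝ)

/-- The set of reward increments `R_m(1,x) − R_m(0,x)` over `x ∈ [lo,hi]^{k'}`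
(on `k' + 1` channels). -/
def RdiffSet (lo hi : ℝ) (m k' : ℕ) : Set ℝ :=
  { r : ℝ | ∃ x : Fin k' → ℝ, (∀ i, x i ∈ Set.Icc lo hi) ∧
      r = expReward m Finset.univ (Fin.cons 1 x) -
          expReward m Finset.univ (Fin.cons 0 x) }

/-- `ℛ̄`: maximal reward increment. -/
def Rbar (lo hi : ℝ) (m k' : ℕ) : ℝ := sSup (RdiffSet lo hi m k')

/-- `ℛ̲`: minimal reward increment. -/
def Rlow (lo hi : ℝ) (m k' : ℕ) : ℝ := sInf (RdiffSet lo hi m k')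

/-- The first `k` channels out of `N` (the myopically sensed channels for a
descending-ordered belief vector). -/
def senseSet (N k : ℕ) : Finset (Fin N) := Finset.univ.filter (fun i => (i : ℕ) < k)

/-- Positively correlated case successor belief vector: `c` copies of `p11`,
then `τ(ω_{k+1}), …, τ(ω_N)`, then `k - c` copies of `p01`. -/
def nextPos (p01 p11 : ℝ) {N : ℕ} (k : ℕ) (ω : Fin N → ℝ) (c : ℕ) : Fin N → ℝ :=
  fun i =>
    if h1 : (i : ℕ) < c then p11
    else if h2 : (i : ℕ) < c + (N - k) then
      tau p01 p11 (ω ⟨k + ((i : ℕ) - c), by have := i.isLt; omega⟩)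
    else p01

/-- Negatively correlated case successor belief vector: `k - c` copies of `p01`,
then `τ(ω_N), τ(ω_{N-1}), …, τ(ω_{k+1})` (reversed), then `c` copies of `p11`. -/
def nextNeg (p01 p11 : ℝ) {N : ℕ} (k : ℕ) (ω : Fin N → ℝ) (c : ℕ) : Fin N → ℝ :=
  fun i =>
    if h1 : (i : ℕ) < k - c then p01
    else if h2 : (i : ℕ) < (k - c) + (N - k) then
      tau p01 p11 (ω ⟨N - 1 - ((i : ℕ) - (k - c)), by have := i.isLt; omega⟩)
    else p11

/-- Myopic value functions for the positively correlated case, indexed by the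
number `s` of remaining steps (so `W_t = Wpos (T - t)`). -/
def Wpos (p01 p11 β : ℝ) (N k m : ℕ) : ℕ → (Fin N → ℝ) → ℝ
  | 0, ω => expReward m (senseSet N k) ω
  | s + 1, ω =>
    expReward m (senseSet N k) ω +
      β * ∑ A ∈ (senseSet N k).powerset,
        (∏ i ∈ A, ω i) * (∏ i ∈ senseSet N k \ A, (1 - ω i)) *
          Wpos p01 p11 β N k m s (nextPos p01 p11 k ω A.card)

/-- Myopic value functions for the negatively correlated case, indexed by the
number `s` of remaining steps (so `W_t = Wneg (T - t)`). -/
def Wneg (p01 p11 β : ℝ) (N k m : ℕ) : ℕ → (Fin N → ℝ) → ℝ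
  | 0, ω => expReward m (senseSet N k) ω
  | s + 1, ω =>
    expReward m (senseSet N k) ω +
      β * ∑ A ∈ (senseSet N k).powerset,
        (∏ i ∈ A, ω i) * (∏ i ∈ senseSet N k \ A, (1 - ω i)) *
          Wneg p01 p11 β N k m s (nextNeg p01 p11 k ω A.card)

/-- Optimal value functions, indexed by the number `s` of remaining steps
(so `V_t = Vopt (T - t)`). -/
def Vopt (p01 p11 β : ℝ) (N k m : ℕ) : ℕ → (Fin N → ℝ) → ℝ
  | 0, ω => sSup { r : ℝ | ∃ π : Finset (Fin N), π.card = k ∧ r = expReward m π ω }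
  | s + 1, ω =>
    sSup { r : ℝ | ∃ π : Finset (Fin N), π.card = k ∧
      r = expReward m π ω +
        β * ∑ B ∈ π.powerset,
          (∏ i ∈ B, ω i) * (∏ i ∈ π \ B, (1 - ω i)) *
            Vopt p01 p11 β N k m s
              (fun j => if j ∈ B then p11 else if j ∈ π then p01 else tau p01 p11 (ω j)) }

/-- The cyclic right shift `(ω_N, ω_1, …, ω_{N-1})`. -/
def cycR {N : ℕ} (ω : Fin N → ℝ) : Fin N → ℝ :=
  fun i =>
    if h : (i : ℕ) = 0 then ω ⟨N - 1, by have := i.isLt; omega⟩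
    else ω ⟨(i : ℕ) - 1, by have := i.isLt; omega⟩

/-- The cyclic left shift `(ω_2, ω_3, …, ω_N, ω_1)`. -/
def cycL {N : ℕ} (ω : Fin N → ℝ) : Fin N → ℝ :=
  fun i =>
    if h : (i : ℕ) + 1 < N then ω ⟨(i : ℕ) + 1, h⟩
    else ω ⟨0, by have := i.isLt; omega⟩

/-- The vector `(ω_1, …, ω_{j-1}, x, y, ω_{j+2}, …, ω_N)` (0-indexed: `x` at
position `j`, `y` at position `j+1`). -/
def swapAt {N : ℕ} (ω : Fin N → ℝ) (j : ℕ) (x y : ℝ) : Fin N → ℝ :=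
  fun i => if (i : ℕ) = j then x else if (i : ℕ) = j + 1 then y else ω i

end

/-- The expectation of `g (number of successes)` for independent Bernoulli trials whose success
probabilities are listed in `l`. -/
def bernExp : List ℝ → (ℕ → ℝ) → ℝ
  | [], g => g 0
  | a :: l, g => a * bernExp l (fun c => g (c + 1)) + (1 - a) * bernExp l g

namespace bernExp

theorem perm {l l' : List ℝ} (h : l.Perm l') (g : ℕ → ℝ) : bernExp l g = bernExp l' g := by
  induction h generalizing g with
  | nil => rfl
  | cons a _ ih => simp only [bernExp, ih]
  | swap a b l => simp only [bernExp]; ring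
  | trans _ _ ih₁ ih₂ => rw [ih₁, ih₂]

theorem add (l : List ℝ) (g h : ℕ → ℝ) :
    bernExp l (fun c => g c + h c) = bernExp l g + bernExp l h := by
  induction l generalizing g h with
  | nil => rfl
  | cons a l ih => simp only [bernExp, ih]; ring

theorem const_mul (l : List ℝ) (r : ℝ) (g : ℕ → ℝ) :
    bernExp l (fun c => r * g c) = r * bernExp l g := by
  induction l generalizing g with
  | nil => rfl
  | cons a l ih => simp only [bernExp, ih]; ring

theorem const (l : List ℝ) (r : ℝ) : bernExp l (fun _ => r) = r := by
  induction l with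
  | nil => rfl
  | cons a l ih => simp only [bernExp, ih]; ring

theorem mono {l : List ℝ} (hl : ∀ a ∈ l, a ∈ Set.Icc (0 : ℝ) 1) {g h : ℕ → ℝ}
    (hgh : ∀ c ≤ l.length, g c ≤ h c) : bernExp l g ≤ bernExp l h := by
  induction l generalizing g h with
  | nil => exact hgh 0 le_rfl
  | cons a l ih =>
    have ha := hl a (by simp)
    have hl' : ∀ a ∈ l, a ∈ Set.Icc (0 : ℝ) 1 := fun b hb => hl b (by simp [hb])
    exact add_le_add
      (mul_le_mul_of_nonneg_left
        (ih hl' fun c hc => hgh (c + 1) (by simpa using hc)) ha.1)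
      (mul_le_mul_of_nonneg_left
        (ih hl' fun c hc => hgh c (by simp only [List.length_cons]; omega))
        (sub_nonneg.2 ha.2))

theorem le_add_const {l : List ℝ} (hl : ∀ a ∈ l, a ∈ Set.Icc (0 : ℝ) 1) {g h : ℕ → ℝ} {r : ℝ}
    (hgh : ∀ c ≤ l.length, g c ≤ h c + r) : bernExp l g ≤ bernExp l h + r := by
  have := mono hl hgh
  rwa [add, const] at this

theorem congr_le {l : List ℝ} {g h : ℕ → ℝ} (hgh : ∀ c ≤ l.length, g c = h c) :
    bernExp l g = bernExp l h := by
  induction l generalizing g h with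
  | nil => exact hgh 0 le_rfl
  | cons a l ih =>
    simp only [bernExp]
    rw [ih fun c hc => hgh (c + 1) (by simpa using hc),
      ih fun c hc => hgh c (by simp only [List.length_cons]; omega)]

theorem one_cons (l : List ℝ) (g : ℕ → ℝ) :
    bernExp (1 :: l) g = bernExp l (fun c => g (c + 1)) := by simp [bernExp]

theorem zero_cons (l : List ℝ) (g : ℕ → ℝ) : bernExp (0 :: l) g = bernExp l g := by
  simp [bernExp]

theorem eq_sum_powerset {ι : Type*} [DecidableEq ι] {l : List ι} (hl : l.Nodup)
    (ω : ι → ℝ) (g : ℕ → ℝ) :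
    ∑ A ∈ l.toFinset.powerset, (∏ i ∈ A, ω i) * (∏ i ∈ l.toFinset \ A, (1 - ω i)) * g A.card =
      bernExp (l.map ω) g := by
  induction l generalizing g with
  | nil => simp [bernExp]
  | cons a l ih =>
    have ha : a ∉ l.toFinset := by simpa using (List.nodup_cons.1 hl).1
    have ih := ih (List.nodup_cons.1 hl).2
    rw [List.toFinset_cons, Finset.sum_powerset_insert ha, List.map_cons, bernExp, ← ih, ← ih,
      Finset.mul_sum, Finset.mul_sum, add_comm]
    congr 1
    · refine Finset.sum_congr rfl fun A hA => ?_
      have haA : a ∉ A := fun h => ha (Finset.mem_powerset.1 hA h)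
      rw [Finset.prod_insert haA, Finset.card_insert_of_notMem haA,
        Finset.insert_sdiff_insert, Finset.sdiff_insert_of_notMem ha]
      ring
    · refine Finset.sum_congr rfl fun A hA => ?_
      have haA : a ∉ A := fun h => ha (Finset.mem_powerset.1 hA h)
      rw [Finset.insert_sdiff_of_notMem _ haA, Finset.prod_insert (by simp [ha])]
      ring

theorem eq_sum_powerset_senseSet {N : ℕ} (k : ℕ) (ω : Fin N → ℝ) (g : ℕ → ℝ) :
    ∑ A ∈ (senseSet N k).powerset,
      (∏ i ∈ A, ω i) * (∏ i ∈ senseSet N k \ A, (1 - ω i)) * g A.card =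
      bernExp ((List.ofFn ω).take k) g := by
  have hS : senseSet N k = ((List.finRange N).take k).toFinset := by
    ext i
    simp only [senseSet, Finset.mem_filter, Finset.mem_univ, true_and, List.mem_toFinset,
      List.mem_take_iff_getElem, List.getElem_finRange, List.length_finRange]
    constructor
    · intro h
      exact ⟨i, by omega, by simp⟩
    · rintro ⟨j, hj, rfl⟩
      exact hj.trans_le (min_le_left _ _)
  rw [hS, eq_sum_powerset ((List.nodup_finRange N).sublist (List.take_sublist _ _)),
    List.map_take, List.ofFn_eq_map]

theorem eq_sum_powerset_univ {n : ℕ} (ω : Fin n → ℝ) (g : ℕ → ℝ) :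
    ∑ A ∈ (univ : Finset (Fin n)).powerset,
      (∏ i ∈ A, ω i) * (∏ i ∈ univ \ A, (1 - ω i)) * g A.card = bernExp (List.ofFn ω) g := by
  have h := eq_sum_powerset (List.nodup_finRange n) ω g
  rwa [List.toFinset_finRange, ← List.ofFn_eq_map] at h

end bernExp

/-- The capped reward increment when one more channel is available. -/
def rewardIncr (m c : ℕ) : ℝ := ((min (c + 1) m : ℕ) : ℝ) - ((min c m : ℕ) : ℝ)

theorem rewardIncr_nonneg (m c : ℕ) : 0 ≤ rewardIncr m c := by
  rw [rewardIncr, sub_nonneg]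
  exact_mod_cast min_le_min_right m (Nat.le_succ c)

theorem rewardIncr_le (m c : ℕ) : rewardIncr m c ≤ 1 := by
  rw [rewardIncr, sub_le_iff_le_add]
  norm_cast
  omega

theorem expReward_cons_sub (m n : ℕ) (x : Fin n → ℝ) :
    expReward m univ (Fin.cons 1 x : Fin (n + 1) → ℝ) -
      expReward m univ (Fin.cons 0 x : Fin (n + 1) → ℝ) =
      bernExp (List.ofFn x) (rewardIncr m) := by
  have h := bernExp.add (List.ofFn x) (rewardIncr m) (fun c => ((min c m : ℕ) : ℝ))
  simp only [rewardIncr, sub_add_cancel] at h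
  unfold expReward
  rw [bernExp.eq_sum_powerset_univ _ (fun c => ((min c m : ℕ) : ℝ)),
    bernExp.eq_sum_powerset_univ _ (fun c => ((min c m : ℕ) : ℝ)), List.ofFn_cons, List.ofFn_cons,
    bernExp.one_cons, bernExp.zero_cons, h, add_sub_cancel_right]

theorem RdiffSet_subset_Icc {lo hi : ℝ} (hlo : 0 ≤ lo) (hhi : hi ≤ 1) (m n : ℕ) :
    RdiffSet lo hi m n ⊆ Set.Icc 0 1 := by
  rintro _ ⟨x, hx, rfl⟩
  rw [expReward_cons_sub]
  have hl : ∀ a ∈ List.ofFn x, a ∈ Set.Icc (0 : ℝ) 1 := by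
    intro a ha
    obtain ⟨i, rfl⟩ := (List.mem_ofFn' _ _).1 ha
    exact ⟨hlo.trans (hx i).1, (hx i).2.trans hhi⟩
  constructor
  · rw [← bernExp.const (List.ofFn x) 0]
    exact bernExp.mono hl fun c _ => rewardIncr_nonneg m c
  · rw [← bernExp.const (List.ofFn x) 1]
    exact bernExp.mono hl fun c _ => rewardIncr_le m c

theorem bernExp_rewardIncr_mem {lo hi : ℝ} (m : ℕ) {l : List ℝ}
    (hl : ∀ a ∈ l, a ∈ Set.Icc lo hi) :
    bernExp l (rewardIncr m) ∈ RdiffSet lo hi m l.length :=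
  ⟨l.get, fun i => hl _ (l.get_mem i), by rw [expReward_cons_sub, List.ofFn_get]⟩

theorem Rbar_nonneg {lo hi : ℝ} (hlo : 0 ≤ lo) (hhi : hi ≤ 1) (m n : ℕ) :
    0 ≤ Rbar lo hi m n :=
  Real.sSup_nonneg fun _ hr => (RdiffSet_subset_Icc hlo hhi m n hr).1

theorem tau_mem {p01 p11 : ℝ} (hp : p01 ≤ p11) {a : ℝ} (ha : a ∈ Set.Icc (0 : ℝ) 1) :
    tau p01 p11 a ∈ Set.Icc p01 p11 := by
  obtain ⟨ha0, ha1⟩ := ha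
  constructor <;> unfold tau <;> nlinarith

theorem tau_mono {p01 p11 : ℝ} (hp : p01 ≤ p11) {a b : ℝ} (hab : a ≤ b) :
    tau p01 p11 a ≤ tau p01 p11 b := by
  unfold tau
  nlinarith

theorem tau_zero (p01 p11 : ℝ) : tau p01 p11 0 = p01 := by simp [tau]

theorem tau_one (p01 p11 : ℝ) : tau p01 p11 1 = p11 := by simp [tau]

/-- List form of `nextPos`, where `l` lists the beliefs of the channels that were not sensed. -/
def nextList (p01 p11 : ℝ) (k : ℕ) (l : List ℝ) (c : ℕ) : List ℝ :=
  List.replicate c p11 ++ (l.map (tau p01 p11) ++ List.replicate (k - c) p01)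

/-- The myopic value with `s` slots to go, as a function of the list of beliefs. -/
def myopicValue (p01 p11 β : ℝ) (k m : ℕ) : ℕ → List ℝ → ℝ
  | 0, _ => 0
  | s + 1, l => bernExp (l.take k) fun c =>
      ((min c m : ℕ) : ℝ) + β * myopicValue p01 p11 β k m s (nextList p01 p11 k (l.drop k) c)

theorem ofFn_nextPos (p01 p11 : ℝ) {N k c : ℕ} (hkN : k ≤ N) (hc : c ≤ k) (ω : Fin N → ℝ) :
    List.ofFn (nextPos p01 p11 k ω c) = nextList p01 p11 k ((List.ofFn ω).drop k) c := by
  apply List.ext_getElem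
  · simp [nextList]; omega
  · intro i h₁ h₂
    simp only [nextList, nextPos, List.getElem_ofFn, List.getElem_append, List.length_replicate,
      List.getElem_replicate, List.length_map, List.length_drop, List.length_ofFn,
      List.getElem_map, List.getElem_drop]
    split_ifs <;> first | rfl | omega

theorem Wpos_eq_myopicValue (p01 p11 β : ℝ) {N k : ℕ} (m : ℕ) (hkN : k ≤ N) (s : ℕ)
    (ω : Fin N → ℝ) :
    Wpos p01 p11 β N k m s ω = myopicValue p01 p11 β k m (s + 1) (List.ofFn ω) := by
  have hR (ω : Fin N → ℝ) : expReward m (senseSet N k) ω =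
      bernExp ((List.ofFn ω).take k) (fun c => ((min c m : ℕ) : ℝ)) :=
    bernExp.eq_sum_powerset_senseSet k ω fun c => ((min c m : ℕ) : ℝ)
  induction s generalizing ω with
  | zero => simp only [Wpos, myopicValue, mul_zero, add_zero, hR]
  | succ s ih =>
    rw [Wpos, hR, bernExp.eq_sum_powerset_senseSet k ω
      (fun c => Wpos p01 p11 β N k m s (nextPos p01 p11 k ω c)), ← bernExp.const_mul,
      ← bernExp.add, myopicValue]
    refine bernExp.congr_le fun c hc => ?_
    rw [ih, ofFn_nextPos p01 p11 hkN
      (hc.trans (List.length_take_le _ _))]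

theorem ofFn_swapAt {N j : ℕ} (hj : j + 1 < N) (ω : Fin N → ℝ) (x y : ℝ) :
    List.ofFn (swapAt ω j x y) =
      (List.ofFn ω).take j ++ x :: y :: (List.ofFn ω).drop (j + 2) := by
  apply List.ext_getElem
  · simp; omega
  · intro i h₁ h₂
    simp only [swapAt, List.getElem_ofFn, List.getElem_append, List.length_take,
      List.length_ofFn, List.getElem_take, List.getElem_cons, List.getElem_drop]
    have : min j N = j := by omega
    simp only [this]
    split_ifs <;> first | rfl | omega | (congr 2; omega)

section myopicValue

variable {p01 p11 β : ℝ} {k m : ℕ}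

local notation "U" => myopicValue p01 p11 β k m

theorem myopicValue_append (s : ℕ) {P C : List ℝ} (hP : P.length = k) :
    U (s + 1) (P ++ C) = bernExp P fun c =>
      ((min c m : ℕ) : ℝ) + β * U s (nextList p01 p11 k C c) := by
  subst hP
  simp [myopicValue]

theorem myopicValue_append_perm (s : ℕ) {P Q : List ℝ} (h : P.Perm Q) (hP : P.length ≤ k)
    (C : List ℝ) : U s (P ++ C) = U s (Q ++ C) := by
  cases s with
  | zero => rfl
  | succ s =>
    have hQ : Q.length ≤ k := h.length_eq ▸ hP
    simp only [myopicValue, List.take_append, List.drop_append, List.take_of_length_le hP,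
      List.take_of_length_le hQ, List.drop_of_length_le hP, List.drop_of_length_le hQ,
      h.length_eq]
    exact bernExp.perm (h.append_right _) _

theorem myopicValue_affine (s : ℕ) (A B : List ℝ) (x : ℝ) :
    U s (A ++ x :: B) = x * U s (A ++ 1 :: B) + (1 - x) * U s (A ++ 0 :: B) := by
  induction s generalizing A B x with
  | zero => simp [myopicValue]
  | succ s ih =>
    rcases lt_or_ge A.length k with hA | hA
    · have h (z : ℝ) : U (s + 1) (A ++ z :: B) = U (s + 1) (z :: A ++ B) := by
        have := myopicValue_append_perm (p01 := p01) (p11 := p11) (β := β) (m := m) (k := k)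
          (s + 1) (P := A ++ [z]) (Q := z :: A) (List.perm_append_singleton z A) (by simpa using hA) B
        simpa using this
      obtain ⟨k, rfl⟩ : ∃ n, k = n + 1 := ⟨k - 1, by omega⟩
      rw [h x, h 1, h 0]
      simp only [myopicValue, List.cons_append, List.take_succ_cons, List.drop_succ_cons,
        bernExp.one_cons, bernExp.zero_cons]
      rfl
    · simp only [myopicValue, List.take_append_of_le_length hA,
        List.drop_append_of_le_length hA, nextList, List.map_append, List.map_cons]
      rw [← bernExp.const_mul, ← bernExp.const_mul, ← bernExp.add]
      congr 1
      funext c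
      have key (z : ℝ) := ih (List.replicate c p11 ++ (A.drop k).map (tau p01 p11))
        (B.map (tau p01 p11) ++ List.replicate (k - c) p01) (tau p01 p11 z)
      simp only [List.append_assoc, List.cons_append] at key ⊢
      rw [key x, key 1, key 0]
      simp only [tau]
      ring

theorem myopicValue_swap_sub (s : ℕ) (A B : List ℝ) (x y : ℝ) :
    U s (A ++ x :: y :: B) - U s (A ++ y :: x :: B) =
      (x - y) * (U s (A ++ 1 :: 0 :: B) - U s (A ++ 0 :: 1 :: B)) := by
  have h (a b : ℝ) := myopicValue_affine (p01 := p01) (p11 := p11) (β := β) (m := m) (k := k)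
    s (A ++ [a]) B b
  simp only [List.append_assoc, List.cons_append, List.nil_append] at h
  rw [myopicValue_affine s A (y :: B) x, myopicValue_affine s A (x :: B) y, h 1 y, h 0 y, h 1 x,
    h 0 x]
  ring

theorem mem_Icc_of_mem_append {lo hi : ℝ} {A B : List ℝ} (hA : ∀ a ∈ A, a ∈ Set.Icc lo hi)
    (hB : ∀ a ∈ B, a ∈ Set.Icc lo hi) : ∀ a ∈ A ++ B, a ∈ Set.Icc lo hi :=
  fun a ha => (List.mem_append.1 ha).elim (hA a) (hB a)

/-- Exchanging adjacent entries in decreasing order does not decrease `F`, on lists with entries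
in `[lo, hi]`. -/
def SwapMono (lo hi : ℝ) (F : List ℝ → ℝ) : Prop :=
  ∀ A B : List ℝ, ∀ x y : ℝ, (∀ a ∈ A, a ∈ Set.Icc lo hi) → (∀ a ∈ B, a ∈ Set.Icc lo hi) →
    x ∈ Set.Icc lo hi → y ∈ Set.Icc lo hi → y ≤ x → F (A ++ y :: x :: B) ≤ F (A ++ x :: y :: B)

/-- Moving the last entry to the front decreases `F` by at most `r`, on lists with entries in
`[lo, hi]`. -/
def RotateBound (lo hi r : ℝ) (F : List ℝ → ℝ) : Prop :=
  ∀ A : List ℝ, ∀ b : ℝ, (∀ a ∈ A, a ∈ Set.Icc lo hi) → b ∈ Set.Icc lo hi →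
    F (A ++ [b]) ≤ F (b :: A) + r

theorem SwapMono.move_left {lo hi : ℝ} {F : List ℝ → ℝ} (hF : SwapMono lo hi F)
    (hle : lo ≤ hi) {A B C : List ℝ} (hA : ∀ a ∈ A, a ∈ Set.Icc lo hi)
    (hB : ∀ a ∈ B, a ∈ Set.Icc lo hi) (hC : ∀ a ∈ C, a ∈ Set.Icc lo hi) :
    F (A ++ (B ++ hi :: C)) ≤ F (A ++ hi :: (B ++ C)) := by
  induction B generalizing A with
  | nil => exact le_rfl
  | cons b B ih =>
    simp only [List.mem_cons, forall_eq_or_imp] at hB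
    have h₁ := ih (A := A ++ [b]) (mem_Icc_of_mem_append hA (by simpa using hB.1)) hB.2
    have h₂ := hF A (B ++ C) hi b hA
      (mem_Icc_of_mem_append hB.2 hC) ⟨hle, le_rfl⟩ hB.1 hB.1.2
    simp only [List.append_assoc, List.cons_append, List.nil_append] at h₁ ⊢
    exact h₁.trans h₂

theorem SwapMono.move_right {lo hi : ℝ} {F : List ℝ → ℝ} (hF : SwapMono lo hi F)
    (hle : lo ≤ hi) {A B C : List ℝ} (hA : ∀ a ∈ A, a ∈ Set.Icc lo hi)
    (hB : ∀ a ∈ B, a ∈ Set.Icc lo hi) (hC : ∀ a ∈ C, a ∈ Set.Icc lo hi) :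
    F (A ++ lo :: (B ++ C)) ≤ F (A ++ (B ++ lo :: C)) := by
  induction B generalizing A with
  | nil => exact le_rfl
  | cons b B ih =>
    simp only [List.mem_cons, forall_eq_or_imp] at hB
    have h₁ := ih (A := A ++ [b]) (mem_Icc_of_mem_append hA (by simpa using hB.1)) hB.2
    have h₂ := hF A (B ++ C) b lo hA
      (mem_Icc_of_mem_append hB.2 hC) hB.1 ⟨le_rfl, hle⟩ hB.1.1
    simp only [List.append_assoc, List.cons_append, List.nil_append] at h₁ ⊢
    exact h₂.trans h₁

theorem RotateBound.insert_lo {lo hi r : ℝ} {F : List ℝ → ℝ} (hr : RotateBound lo hi r F)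
    (hF : SwapMono lo hi F) (hle : lo ≤ hi) {A B : List ℝ} (hA : ∀ a ∈ A, a ∈ Set.Icc lo hi)
    (hB : ∀ a ∈ B, a ∈ Set.Icc lo hi) :
    F (A ++ (B ++ [lo])) ≤ F (A ++ lo :: B) + r := by
  have h₁ := hr (A ++ B) lo (mem_Icc_of_mem_append hA hB) ⟨le_rfl, hle⟩
  have h₂ := hF.move_right hle (A := []) (by simp) hA hB
  simp only [List.append_assoc, List.nil_append] at h₁ h₂
  linarith

end myopicValue

section succ

variable {p01 p11 β : ℝ} {k m : ℕ}

local notation "U" => myopicValue p01 p11 β (k + 1) m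

theorem mem_Icc_of_mem_replicate {lo hi b : ℝ} (hb : b ∈ Set.Icc lo hi) (n : ℕ) :
    ∀ a ∈ List.replicate n b, a ∈ Set.Icc lo hi := fun _ ha => List.eq_of_mem_replicate ha ▸ hb

theorem mem_Icc_of_mem_map_tau (h0 : 0 ≤ p01) (h1 : p11 ≤ 1) (hp : p01 ≤ p11) {l : List ℝ}
    (hl : ∀ a ∈ l, a ∈ Set.Icc p01 p11) : ∀ a ∈ l.map (tau p01 p11), a ∈ Set.Icc p01 p11 := by
  intro a ha
  obtain ⟨b, hb, rfl⟩ := List.mem_map.1 ha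
  exact tau_mem hp ⟨h0.trans (hl b hb).1, (hl b hb).2.trans h1⟩

theorem nextList_succ_eq (C : List ℝ) {c : ℕ} (hc : c ≤ k) :
    nextList p01 p11 (k + 1) (1 :: C) c = nextList p01 p11 (k + 1) (C ++ [0]) (c + 1) := by
  have : k + 1 - c = (k - c) + 1 := by omega
  rw [nextList, nextList, this, List.replicate_succ, Nat.add_sub_add_right]
  simp [tau_one, tau_zero, List.replicate_succ']

/-- Replacing the outcome "last sensed channel bad, next channel good" by its reverse costs at
most `r` in the next slot. -/
theorem myopicValue_nextList_one_cons_le (h0 : 0 ≤ p01) (h1 : p11 ≤ 1) (hp : p01 ≤ p11) {s : ℕ}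
    {r : ℝ} (hS : SwapMono p01 p11 (U s)) (hR : RotateBound p01 p11 r (U s)) {C : List ℝ}
    (hC : ∀ a ∈ C, a ∈ Set.Icc p01 p11) {c : ℕ} (hc : c ≤ k) :
    U s (nextList p01 p11 (k + 1) (1 :: C) c) ≤
      U s (nextList p01 p11 (k + 1) (0 :: C) (c + 1)) + r := by
  have h := hR.insert_lo hS hp
    (mem_Icc_of_mem_replicate (b := p11) ⟨hp, le_rfl⟩ (c + 1))
    (mem_Icc_of_mem_append (mem_Icc_of_mem_map_tau h0 h1 hp hC)
      (mem_Icc_of_mem_replicate (b := p01) ⟨le_rfl, hp⟩ (k - c)))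
  have e : k + 1 - c = (k - c) + 1 := by omega
  simpa [nextList, tau_one, tau_zero, List.replicate_succ', e] using h

theorem bernExp_min_succ_add (m : ℕ) (A : List ℝ) (h : ℕ → ℝ) :
    bernExp A (fun c => ((min (c + 1) m : ℕ) : ℝ) + h c) =
      bernExp A (rewardIncr m) + bernExp A (fun c => ((min c m : ℕ) : ℝ) + h c) := by
  rw [← bernExp.add]
  congr 1
  funext c
  rw [rewardIncr]
  ring

theorem myopicValue_append_cons_one (s : ℕ) {A : List ℝ} (hA : A.length = k) (C : List ℝ) :
    U (s + 1) (A ++ 1 :: C) = bernExp A fun c =>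
      ((min (c + 1) m : ℕ) : ℝ) + β * U s (nextList p01 p11 (k + 1) C (c + 1)) := by
  rw [List.append_cons, myopicValue_append s (by simp [hA]),
    bernExp.perm (List.perm_append_singleton 1 A), bernExp.one_cons]

theorem myopicValue_append_cons_zero (s : ℕ) {A : List ℝ} (hA : A.length = k) (C : List ℝ) :
    U (s + 1) (A ++ 0 :: C) = bernExp A fun c =>
      ((min c m : ℕ) : ℝ) + β * U s (nextList p01 p11 (k + 1) C c) := by
  rw [List.append_cons, myopicValue_append s (by simp [hA]),
    bernExp.perm (List.perm_append_singleton 0 A), bernExp.zero_cons]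

variable (h0 : 0 ≤ p01) (h1 : p11 ≤ 1) (hp : p01 ≤ p11) (hβ0 : 0 ≤ β) {r d : ℝ}
  (hd : ∀ A : List ℝ, A.length = k → (∀ a ∈ A, a ∈ Set.Icc p01 p11) →
    bernExp A (rewardIncr m) ∈ Set.Icc d r) (hdr : β * r ≤ d)
include h0 h1 hp hβ0 hd hdr

theorem SwapMono.succ {s : ℕ} (hS : SwapMono p01 p11 (U s)) (hR : RotateBound p01 p11 r (U s)) :
    SwapMono p01 p11 (U (s + 1)) := by
  intro A B x y hA hB hx hy hxy
  rcases lt_trichotomy A.length k with hk | hk | hk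
  · have := myopicValue_append_perm (p01 := p01) (p11 := p11) (β := β) (m := m) (k := k + 1)
      (s + 1) (P := A ++ [y, x]) (Q := A ++ [x, y]) ((List.Perm.swap x y []).append_left A)
      (by simp; omega) B
    simpa using this.le
  · rw [← sub_nonneg, myopicValue_swap_sub]
    refine mul_nonneg (sub_nonneg.2 hxy) (sub_nonneg.2 ?_)
    rw [myopicValue_append_cons_zero s hk, myopicValue_append_cons_one s hk,
      bernExp_min_succ_add]
    have hA' : ∀ a ∈ A, a ∈ Set.Icc (0 : ℝ) 1 :=
      fun a ha => ⟨h0.trans (hA a ha).1, (hA a ha).2.trans h1⟩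
    have h := bernExp.le_add_const hA' (r := β * r) (g := fun c => ((min c m : ℕ) : ℝ) +
        β * U s (nextList p01 p11 (k + 1) (1 :: B) c))
      (h := fun c => ((min c m : ℕ) : ℝ) +
        β * U s (nextList p01 p11 (k + 1) (0 :: B) (c + 1))) (fun c hc => by
          have := mul_le_mul_of_nonneg_left
            (myopicValue_nextList_one_cons_le h0 h1 hp hS hR hB (hc.trans hk.le)) hβ0
          linarith)
    linarith [(hd A hk hA).1]
  · simp only [myopicValue]
    have hk : k + 1 ≤ A.length := hk
    rw [List.take_append_of_le_length hk, List.take_append_of_le_length hk,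
      List.drop_append_of_le_length hk, List.drop_append_of_le_length hk]
    refine bernExp.mono (fun a ha => ?_) fun c _ => ?_
    · have := hA a (List.mem_of_mem_take ha)
      exact ⟨h0.trans this.1, this.2.trans h1⟩
    · have h := hS (List.replicate c p11 ++ (A.drop (k + 1)).map (tau p01 p11))
        (B.map (tau p01 p11) ++ List.replicate (k + 1 - c) p01) (tau p01 p11 x) (tau p01 p11 y)
        (mem_Icc_of_mem_append (mem_Icc_of_mem_replicate ⟨hp, le_rfl⟩ _)
          (mem_Icc_of_mem_map_tau h0 h1 hp fun a ha => hA a (List.mem_of_mem_drop ha)))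
        (mem_Icc_of_mem_append (mem_Icc_of_mem_map_tau h0 h1 hp hB)
          (mem_Icc_of_mem_replicate ⟨le_rfl, hp⟩ _))
        (tau_mem hp ⟨h0.trans hx.1, hx.2.trans h1⟩) (tau_mem hp ⟨h0.trans hy.1, hy.2.trans h1⟩)
        (tau_mono hp hxy)
      have h := mul_le_mul_of_nonneg_left h hβ0
      simp only [nextList, List.map_append, List.map_cons, List.append_assoc,
        List.cons_append] at h ⊢
      linarith

theorem RotateBound.succ (hβ1 : β ≤ 1) (hr : 0 ≤ r) {s : ℕ} (hS : SwapMono p01 p11 (U s))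
    (hR : RotateBound p01 p11 r (U s)) : RotateBound p01 p11 r (U (s + 1)) := by
  intro A b hA hb
  rcases le_or_gt A.length k with hk | hk
  · have := myopicValue_append_perm (p01 := p01) (p11 := p11) (β := β) (m := m) (k := k + 1)
      (s + 1) (List.perm_append_singleton b A) (by simpa using hk) []
    simp only [List.append_nil] at this
    linarith
  obtain ⟨P, a, C, rfl, hP⟩ : ∃ P a C, A = P ++ a :: C ∧ P.length = k :=
    ⟨A.take k, A[k], A.drop (k + 1), by simp, by simp; omega⟩
  simp only [List.mem_append, List.mem_cons, or_imp, forall_and, forall_eq] at hA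
  obtain ⟨hPI, haI, hCI⟩ := hA
  have hP' : ∀ a ∈ P, a ∈ Set.Icc (0 : ℝ) 1 :=
    fun a ha => ⟨h0.trans (hPI a ha).1, (hPI a ha).2.trans h1⟩
  have ha' : 0 ≤ a ∧ a ≤ 1 := ⟨h0.trans haI.1, haI.2.trans h1⟩
  have hb' : 0 ≤ b ∧ b ≤ 1 := ⟨h0.trans hb.1, hb.2.trans h1⟩
  have hCτ := mem_Icc_of_mem_map_tau h0 h1 hp hCI
  have hhi (n : ℕ) : ∀ a ∈ List.replicate n p11, a ∈ Set.Icc p01 p11 :=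
    mem_Icc_of_mem_replicate ⟨hp, le_rfl⟩ n
  have hlo (n : ℕ) : ∀ a ∈ List.replicate n p01, a ∈ Set.Icc p01 p11 :=
    mem_Icc_of_mem_replicate ⟨le_rfl, hp⟩ n
  obtain ⟨hdP, hrP⟩ := hd P hP hPI
  have hβr : β * r ≤ r := mul_le_of_le_one_left hr hβ1
  have hfront (z w : ℝ) : U (s + 1) (z :: (P ++ w :: C)) = U (s + 1) (P ++ z :: w :: C) := by
    have := myopicValue_append_perm (p01 := p01) (p11 := p11) (β := β) (m := m) (k := k + 1)
      (s + 1) (List.perm_append_singleton z P) (by simp [hP]) (w :: C)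
    simpa using this.symm
  have hmove (c : ℕ) : U s (nextList p01 p11 (k + 1) (C ++ [1]) c) ≤
      U s (nextList p01 p11 (k + 1) (1 :: C) c) := by
    have := hS.move_left hp (hhi c) hCτ (hlo (k + 1 - c))
    simpa [nextList, tau_one] using this
  have h11 : U (s + 1) (P ++ 1 :: (C ++ [1])) ≤ U (s + 1) (P ++ 1 :: 1 :: C) := by
    rw [myopicValue_append_cons_one s hP, myopicValue_append_cons_one s hP]
    refine bernExp.mono hP' fun c _ => ?_
    have := mul_le_mul_of_nonneg_left (hmove (c + 1)) hβ0
    linarith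
  have h00 : U (s + 1) (P ++ 0 :: (C ++ [0])) ≤ U (s + 1) (P ++ 0 :: 0 :: C) + r := by
    rw [myopicValue_append_cons_zero s hP, myopicValue_append_cons_zero s hP]
    refine bernExp.le_add_const hP' fun c _ => ?_
    have h := hR.insert_lo hS hp (hhi c) (mem_Icc_of_mem_append hCτ (hlo (k + 1 - c)))
    have e : U s (nextList p01 p11 (k + 1) (C ++ [0]) c) ≤
        U s (nextList p01 p11 (k + 1) (0 :: C) c) + r := by
      have e : p01 :: List.replicate (k + 1 - c) p01 = List.replicate (k + 1 - c) p01 ++ [p01] := by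
        rw [← List.replicate_succ, List.replicate_succ']
      simpa [nextList, tau_zero, e] using h
    have := mul_le_mul_of_nonneg_left e hβ0
    linarith
  have h10 : U (s + 1) (P ++ 1 :: (C ++ [0])) ≤ U (s + 1) (P ++ 0 :: 1 :: C) + r := by
    rw [myopicValue_append_cons_one s hP, myopicValue_append_cons_zero s hP,
      bernExp_min_succ_add, add_comm]
    refine add_le_add (bernExp.mono hP' fun c hc => ?_) hrP
    rw [nextList_succ_eq C (hc.trans hP.le)]
  have h01 : U (s + 1) (P ++ 0 :: (C ++ [1])) ≤ U (s + 1) (P ++ 1 :: 0 :: C) := by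
    rw [myopicValue_append_cons_one s hP, myopicValue_append_cons_zero s hP,
      bernExp_min_succ_add]
    have h := bernExp.le_add_const hP' (r := β * r) (g := fun c => ((min c m : ℕ) : ℝ) +
        β * U s (nextList p01 p11 (k + 1) (C ++ [1]) c))
      (h := fun c => ((min c m : ℕ) : ℝ) +
        β * U s (nextList p01 p11 (k + 1) (0 :: C) (c + 1))) (fun c hc => by
          have := mul_le_mul_of_nonneg_left ((hmove c).trans
            (myopicValue_nextList_one_cons_le h0 h1 hp hS hR hCI (hc.trans hP.le))) hβ0
          linarith)
    linarith
  have hlast (z : ℝ) := myopicValue_affine (p01 := p01) (p11 := p11) (β := β) (m := m)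
    (k := k + 1) (s + 1) (P ++ z :: C) [] b
  have hsnd (z : ℝ) := myopicValue_affine (p01 := p01) (p11 := p11) (β := β) (m := m)
    (k := k + 1) (s + 1) (P ++ [z]) C a
  simp only [List.append_assoc, List.cons_append, List.nil_append] at hlast hsnd ⊢
  rw [hfront, myopicValue_affine (s + 1) P (C ++ [b]) a, hlast 1, hlast 0,
    myopicValue_affine (s + 1) P (a :: C) b, hsnd 1, hsnd 0]
  have i11 := mul_le_mul_of_nonneg_left h11 (mul_nonneg ha'.1 hb'.1)
  have i10 := mul_le_mul_of_nonneg_left h10 (mul_nonneg ha'.1 (sub_nonneg.2 hb'.2))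
  have i01 := mul_le_mul_of_nonneg_left h01 (mul_nonneg (sub_nonneg.2 ha'.2) hb'.1)
  have i00 := mul_le_mul_of_nonneg_left h00
    (mul_nonneg (sub_nonneg.2 ha'.2) (sub_nonneg.2 hb'.2))
  have hbr := mul_nonneg hb'.1 hr
  linarith

theorem myopicValue_swapMono_and_rotateBound (hβ1 : β ≤ 1) (hr : 0 ≤ r) (s : ℕ) :
    SwapMono p01 p11 (U s) ∧ RotateBound p01 p11 r (U s) := by
  induction s with
  | zero =>
    exact ⟨fun _ _ _ _ _ _ _ _ _ => le_rfl, fun _ _ _ _ => by simpa [myopicValue] using hr⟩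
  | succ s ih =>
    exact ⟨ih.1.succ h0 h1 hp hβ0 hd hdr ih.2, ih.2.succ h0 h1 hp hβ0 hd hdr hβ1 hr ih.1⟩

end succ

/-- key inequality L2 (adjacent-swap inequality) for positively
correlated channels. -/
theorem Wpos_L2 (p01 p11 β : ℝ) (h0 : p01 ∈ Set.Icc (0 : ℝ) 1)
    (h1 : p11 ∈ Set.Icc (0 : ℝ) 1) (hp : p01 ≤ p11)
    (N k m T : ℕ) (hm : 1 ≤ m) (hmk : m ≤ k) (hkN : k ≤ N) (hT : 1 ≤ T)
    (hβ0 : 0 ≤ β) (hβ1 : β ≤ 1)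
    (hcond : β * Rbar p01 p11 m (k - 1) ≤ Rlow p01 p11 m (k - 1)) :
    ∀ t, 1 ≤ t → t ≤ T → ∀ j : ℕ, 1 ≤ j → j ≤ N - 1 → ∀ ω : Fin N → ℝ,
      (∀ i, ω i ∈ Set.Icc p01 p11) → Antitone ω →
      ∀ x y : ℝ, x ∈ Set.Icc p01 p11 → y ∈ Set.Icc p01 p11 → y ≤ x →
      Wpos p01 p11 β N k m (T - t) (swapAt ω (j - 1) x y) ≥
        Wpos p01 p11 β N k m (T - t) (swapAt ω (j - 1) y x) := by
  obtain ⟨k, rfl⟩ : ∃ n, k = n + 1 := ⟨k - 1, by omega⟩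
  intro t _ _ j hj hjN ω hω _ x y hx hy hxy
  have hsub := RdiffSet_subset_Icc h0.1 h1.2 m k
  have hd : ∀ A : List ℝ, A.length = k → (∀ a ∈ A, a ∈ Set.Icc p01 p11) →
      bernExp A (rewardIncr m) ∈ Set.Icc (Rlow p01 p11 m k) (Rbar p01 p11 m k) := by
    rintro A rfl hA
    have hmem := bernExp_rewardIncr_mem m hA
    exact ⟨csInf_le (bddBelow_Icc.mono hsub) hmem, le_csSup (bddAbove_Icc.mono hsub) hmem⟩
  have hswap := (myopicValue_swapMono_and_rotateBound h0.1 h1.2 hp hβ0 hd hcond hβ1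
    (Rbar_nonneg h0.1 h1.2 m k) (T - t + 1)).1
  have hl : ∀ a ∈ List.ofFn ω, a ∈ Set.Icc p01 p11 := by
    intro a ha
    obtain ⟨i, rfl⟩ := (List.mem_ofFn' _ _).1 ha
    exact hω i
  rw [ge_iff_le, Wpos_eq_myopicValue _ _ _ _ hkN, Wpos_eq_myopicValue _ _ _ _ hkN,
    ofFn_swapAt (by omega), ofFn_swapAt (by omega)]
  exact hswap _ _ x y (fun a ha => hl a (List.mem_of_mem_take ha))
    (fun a ha => hl a (List.mem_of_mem_drop ha)) hx hy hxy
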